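/- The improper integral ∫_0^∞ [ψ(1+u) − log u − 1/(2(1+u))] du converges and equals (1/2)·log(2π). -/

import Mathlib

open Real Filter MeasureTheory Topology

/-- The digamma function `ψ(x) = Γ'(x)/Γ(x)`. -/
noncomputable def digamma (x : ℝ) : ℝ := deriv Real.Gamma x / Real.Gamma x

lemma dg_hasDerivAt (x : ℝ) (hx : 0 < x) :
    HasDerivAt (fun y => Real.log (Real.Gamma y)) (digamma x) x := by
  have h : DifferentiableAt ℝ Real.Gamma x :=
    Real.differentiableAt_Gamma (fun m => by
      have : (0:ℝ) ≤ m := Nat.cast_nonneg m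
      linarith)
  exact h.hasDerivAt.log (Real.Gamma_pos_of_pos hx).ne'

lemma dg_add_one (x : ℝ) (hx : 0 < x) : digamma (x + 1) = digamma x + 1 / x := by
  have h1 : HasDerivAt (fun y => Real.log (Real.Gamma (y + 1))) (digamma (x + 1)) x :=
    (dg_hasDerivAt (x + 1) (by linarith)).comp_add_const x 1
  have h2 : HasDerivAt (fun y => Real.log (Real.Gamma y) + Real.log y)
      (digamma x + 1 / x) x := by
    have := (dg_hasDerivAt x hx).add (Real.hasDerivAt_log hx.ne')
    rw [one_div]; exact this
  have h3 : (fun y => Real.log (Real.Gamma (y + 1))) =ᶠ[𝓝 x]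
      (fun y => Real.log (Real.Gamma y) + Real.log y) := by
    filter_upwards [lt_mem_nhds hx] with y hy
    rw [Real.Gamma_add_one hy.ne', Real.log_mul hy.ne' (Real.Gamma_pos_of_pos hy).ne', add_comm]
  exact (h2.congr_of_eventuallyEq h3).unique h1 |>.symm

lemma dg_log_le (x : ℝ) (hx : 0 < x) : Real.log x ≤ digamma (1 + x) := by
  have h := Real.convexOn_log_Gamma.slope_le_of_hasDerivAt (x := x) (y := 1 + x)
    (f' := digamma (1 + x)) hx (by simp; linarith) (by linarith)
    (dg_hasDerivAt (1 + x) (by linarith))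
  rw [slope_def_field] at h
  simp only [Function.comp] at h
  rw [add_comm 1 x, Real.Gamma_add_one hx.ne',
    Real.log_mul hx.ne' (Real.Gamma_pos_of_pos hx).ne'] at h
  rw [add_comm 1 x]
  simpa using h

lemma dg_step (u : ℝ) (hu : 0 < u) :
    digamma (1 + (u + 1)) - Real.log (u + 1) - 1 / (2 * (1 + (u + 1))) ≤
    digamma (1 + u) - Real.log u - 1 / (2 * (1 + u)) := by
  have h1 := dg_add_one (1 + u) (by linarith)
  have h2 := Real.le_log_one_add_of_nonneg (x := 1 / u) (by positivity)
  have h3 : Real.log (1 + 1 / u) = Real.log (u + 1) - Real.log u := by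
    rw [← Real.log_div (by linarith) hu.ne']; congr 1; field_simp
  rw [h3] at h2
  have h4 : 2 * (1 / u) / (1 / u + 2) = 2 / (2 * u + 1) := by field_simp; ring
  rw [h4] at h2
  have h5 : 1 / (1 + u) + 1 / (2 * (1 + u)) - 1 / (2 * (1 + (u + 1))) ≤ 2 / (2 * u + 1) := by
    rw [← sub_nonneg]
    have : 2 / (2 * u + 1) - (1 / (1 + u) + 1 / (2 * (1 + u)) - 1 / (2 * (1 + (u + 1))))
      = 3 / (2 * (1 + u) * (u + 2) * (2 * u + 1)) := by
      have : 1 + (u + 1) ≠ 0 := by positivity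
      have : u + 2 ≠ 0 := by positivity
      field_simp; ring
    rw [this]; positivity
  have h6 : 1 + (u + 1) = 1 + u + 1 := by ring
  rw [h6] at h5 ⊢
  linarith

lemma dg_nonneg (u : ℝ) (hu : 0 < u) :
    0 ≤ digamma (1 + u) - Real.log u - 1 / (2 * (1 + u)) := by
  have h : ∀ n : ℕ, digamma (1 + (u + n)) - Real.log (u + n) - 1 / (2 * (1 + (u + n))) ≤
      digamma (1 + u) - Real.log u - 1 / (2 * (1 + u)) := by
    intro n
    induction n with
    | zero => simp
    | succ n ih =>
      refine le_trans ?_ ih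
      have := dg_step (u + n) (by positivity)
      push_cast
      rw [← add_assoc u]
      exact this
  have h' : ∀ n : ℕ, - (1 / (2 * (1 + (u + n)))) ≤
      digamma (1 + u) - Real.log u - 1 / (2 * (1 + u)) := by
    intro n
    have := dg_log_le (u + n) (by positivity)
    linarith [h n]
  have hl : Tendsto (fun n : ℕ => - (1 / (2 * (1 + (u + (n:ℝ)))))) atTop (𝓝 (-0)) := by
    apply Tendsto.neg
    simp only [one_div]
    apply tendsto_inv_atTop_zero.comp
    apply Tendsto.const_mul_atTop (by norm_num)
    apply tendsto_atTop_add_const_left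
    apply tendsto_atTop_add_const_left
    exact tendsto_natCast_atTop_atTop
  rw [neg_zero] at hl
  exact le_of_tendsto' hl h'

/-- An antiderivative of the integrand. -/
noncomputable def dgF (u : ℝ) : ℝ :=
  Real.log (Real.Gamma (1 + u)) - u * Real.log u + u - 1 / 2 * Real.log (1 + u)

lemma dgF_deriv (u : ℝ) (hu : 0 < u) :
    HasDerivAt dgF (digamma (1 + u) - Real.log u - 1 / (2 * (1 + u))) u := by
  have h1 := (dg_hasDerivAt (1 + u) (by linarith)).comp_const_add 1 u
  have h2 := Real.hasDerivAt_mul_log hu.ne'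
  have h3 := ((Real.hasDerivAt_log (x := 1 + u) (by linarith)).comp_const_add 1 u).const_mul (1 / 2)
  have := ((h1.sub h2).add (hasDerivAt_id u)).sub h3
  have e : digamma (1 + u) - Real.log u - 1 / (2 * (1 + u)) =
      digamma (1 + u) - (Real.log u + 1) + 1 - 1 / 2 * (1 + u)⁻¹ := by
    rw [one_div, mul_inv]; ring
  rw [e]
  exact this

lemma dgF_cont : ContinuousOn dgF (Set.Ici 0) := by
  intro u hu
  have hu : 0 ≤ u := hu
  apply ContinuousAt.continuousWithinAt
  have h1 := ((dg_hasDerivAt (1 + u) (by linarith)).comp_const_add 1 u).continuousAt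
  have h2 := Real.continuous_mul_log.continuousAt (x := u)
  have h3 := ((Real.hasDerivAt_log (x := 1 + u) (by linarith)).comp_const_add 1 u).continuousAt
  exact ((h1.sub h2).add continuousAt_id).sub (h3.const_mul (1 / 2))

lemma dgF_mono : MonotoneOn dgF (Set.Ici 0) := by
  apply monotoneOn_of_deriv_nonneg (convex_Ici 0) dgF_cont
  · intro x hx
    rw [interior_Ici] at hx
    exact (dgF_deriv x hx).differentiableAt.differentiableWithinAt
  · intro x hx
    rw [interior_Ici] at hx
    rw [(dgF_deriv x hx).deriv]
    exact dg_nonneg x hx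

lemma dgF_nat : Tendsto (fun n : ℕ => dgF n) atTop (𝓝 ((1 / 2) * Real.log (2 * π))) := by
  have h1 : Tendsto (fun n => Real.log (Stirling.stirlingSeq n)) atTop (𝓝 (Real.log (√π))) :=
    Stirling.tendsto_stirlingSeq_sqrt_pi.log (by positivity)
  have h2 : Tendsto (fun n : ℕ => 1 / 2 * Real.log ((n : ℝ) / (n + 1))) atTop
      (𝓝 (1 / 2 * Real.log 1)) :=
    ((tendsto_natCast_div_add_atTop (1 : ℝ)).log one_ne_zero).const_mul _
  have h3 := (h1.add h2).add_const (1 / 2 * Real.log 2)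
  have e : Real.log (√π) + 1 / 2 * Real.log 1 + 1 / 2 * Real.log 2
      = (1 / 2) * Real.log (2 * π) := by
    rw [Real.log_sqrt pi_pos.le, Real.log_mul two_ne_zero pi_ne_zero, Real.log_one]; ring
  rw [e] at h3
  refine h3.congr' ?_
  filter_upwards [eventually_gt_atTop 0] with n hn
  have hn' : (0 : ℝ) < n := by exact_mod_cast hn
  rw [Stirling.log_stirlingSeq_formula, dgF, add_comm 1 (n : ℝ), Real.Gamma_nat_eq_factorial,
    Real.log_div hn'.ne' (by positivity), Real.log_div hn'.ne' (by positivity),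
    Real.log_mul two_ne_zero hn'.ne', Real.log_exp]
  ring

lemma dgF_lim : Tendsto dgF atTop (𝓝 ((1 / 2) * Real.log (2 * π))) := by
  have hm : Monotone (fun u => dgF (max u 0)) := fun a b hab =>
    dgF_mono (Set.mem_Ici.2 (le_max_right _ _)) (Set.mem_Ici.2 (le_max_right _ _)) (max_le_max_right 0 hab)
  have key : Tendsto (fun u => dgF (max u 0)) atTop (𝓝 ((1 / 2) * Real.log (2 * π))) := by
    have hn : Tendsto (fun n : ℕ => dgF (max (n : ℝ) 0)) atTop
        (𝓝 ((1 / 2) * Real.log (2 * π))) := by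
      refine dgF_nat.congr fun n => ?_
      rw [max_eq_left (Nat.cast_nonneg n)]
    rcases tendsto_of_monotone hm with h | ⟨l, hl⟩
    · exact absurd (h.comp tendsto_natCast_atTop_atTop) (not_tendsto_atTop_of_tendsto_nhds hn)
    · have := tendsto_nhds_unique (hl.comp tendsto_natCast_atTop_atTop) hn
      rwa [this] at hl
  refine key.congr' ?_
  filter_upwards [eventually_ge_atTop 0] with u hu
  rw [max_eq_left hu]

/-- `∫_0^∞ [ψ(1+u) − log u − 1/(2(1+u))] du` converges and equals `(1/2) log(2π)`. -/
theorem integral_digamma_sub_log_sub_inv :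
    IntegrableOn (fun u : ℝ => digamma (1 + u) - Real.log u - 1 / (2 * (1 + u)))
      (Set.Ioi 0) ∧
    ∫ u in Set.Ioi (0 : ℝ), (digamma (1 + u) - Real.log u - 1 / (2 * (1 + u))) =
      (1 / 2) * Real.log (2 * π) := by
  have hc : ContinuousWithinAt dgF (Set.Ici 0) 0 := dgF_cont 0 (by simp)
  have hd : ∀ x ∈ Set.Ioi (0 : ℝ), HasDerivAt dgF
      (digamma (1 + x) - Real.log x - 1 / (2 * (1 + x))) x := fun x hx => dgF_deriv x hx
  have hp : ∀ x ∈ Set.Ioi (0 : ℝ),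
      0 ≤ digamma (1 + x) - Real.log x - 1 / (2 * (1 + x)) := fun x hx => dg_nonneg x hx
  refine ⟨integrableOn_Ioi_deriv_of_nonneg hc hd hp dgF_lim, ?_⟩
  rw [integral_Ioi_of_hasDerivAt_of_nonneg hc hd hp dgF_lim]
  simp [dgF]
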